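/- Let q be odd and let 𝒻 ⊆ 𝕄 be an intersecting family, i.e. for all f, g ∈ 𝒻 there exists x ∈ ℙ¹ with f(x) = g(x). Fix points P, Q ∈ ℙ¹, and set S = { f ∈ 𝒻 : f(P) = Q } and T = 𝒻 \ S. Then, as real numbers, |S|·|T| ≤ q(q²−1)·(1 − |S|/(q(q−1)))·(1 − |T|/(q²(q−1))). -/

import Mathlib

noncomputable section

/-- The map `ℙ¹ → ℙ¹` induced by an invertible 2×2 matrix `M` over `F`,
sending the class of `v` to the class of `M v`. -/
def indMap {F : Type} [Field F] (M : GL (Fin 2) F) :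
    Projectivization F (Fin 2 → F) → Projectivization F (Fin 2 → F) :=
  Projectivization.map
    ((Matrix.GeneralLinearGroup.toLin M).toLinearEquiv : (Fin 2 → F) →ₗ[F] (Fin 2 → F))
    (Matrix.GeneralLinearGroup.toLin M).toLinearEquiv.injective

/-- The set `𝕄` of all maps `ℙ¹ → ℙ¹` induced by invertible 2×2 matrices over `F`,
i.e. the elements of `PGL(2,q)` acting on the projective line. -/
def pglMaps (F : Type) [Field F] :
    Set (Projectivization F (Fin 2 → F) → Projectivization F (Fin 2 → F)) :=
  Set.range indMap

open Classical in
/-- The real-valued indicator function of the nonsquares of a field. -/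
def nonsqInd {F : Type} [Field F] (z : F) : ℝ := if IsSquare z then 0 else 1

lemma nonsqInd_of_isSquare {F : Type} [Field F] {z : F} (h : IsSquare z) : nonsqInd z = 0 :=
  if_pos h

lemma nonsqInd_of_not_isSquare {F : Type} [Field F] {z : F} (h : ¬ IsSquare z) :
    nonsqInd z = 1 :=
  if_neg h

lemma nonsqInd_mul_self {F : Type} [Field F] (z : F) : nonsqInd z * nonsqInd z = nonsqInd z := by
  unfold nonsqInd; split_ifs <;> simp

lemma nonsqInd_sq_mul {F : Type} [Field F] {c : F} (hc : c ≠ 0) (z : F) :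
    nonsqInd (c ^ 2 * z) = nonsqInd z := by
  have : IsSquare (c ^ 2 * z) ↔ IsSquare z := by
    constructor
    · rintro ⟨d, hd⟩
      exact ⟨d / c, by field_simp; linear_combination hd⟩
    · exact fun h => (IsSquare.sq c).mul h
  by_cases h : IsSquare z
  · rw [nonsqInd_of_isSquare h, nonsqInd_of_isSquare (this.2 h)]
  · rw [nonsqInd_of_not_isSquare h, nonsqInd_of_not_isSquare (mt this.1 h)]

lemma nonsqInd_eq_quadraticChar {F : Type} [Field F] [Fintype F] [DecidableEq F] (z : F) :
    nonsqInd z = (1 - (quadraticChar F z : ℝ) - if z = 0 then 1 else 0) / 2 := by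
  by_cases hz : z = 0
  · simp [hz, nonsqInd]
  by_cases h : IsSquare z
  · rw [nonsqInd_of_isSquare h, (quadraticChar_one_iff_isSquare hz).2 h]; simp [hz]
  · rw [nonsqInd_of_not_isSquare h, quadraticChar_neg_one_iff_not_isSquare.2 h]; simp [hz]

lemma sum_nonsqInd {F : Type} [Field F] [Fintype F] (hF : ringChar F ≠ 2) :
    ∑ z : F, nonsqInd z = ((Fintype.card F : ℝ) - 1) / 2 := by
  classical
  have h : ∑ z : F, (quadraticChar F z : ℝ) = 0 := by
    exact_mod_cast congrArg (Int.cast : ℤ → ℝ) (quadraticChar_sum_zero hF)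
  simp_rw [nonsqInd_eq_quadraticChar, ← Finset.sum_div, Finset.sum_sub_distrib, h]
  simp

lemma sum_comp_affine {F : Type} [Field F] [Fintype F] (g : F → ℝ) {c : F} (hc : c ≠ 0) (d : F) :
    ∑ z : F, g (c * z + d) = ∑ z : F, g z :=
  ((Equiv.mulLeft₀ c hc).trans (Equiv.addRight d)).sum_comp g

lemma sum_nonsqInd_affine {F : Type} [Field F] [Fintype F] (hF : ringChar F ≠ 2)
    {c : F} (hc : c ≠ 0) (d : F) :
    ∑ z : F, nonsqInd (c * z + d) = ((Fintype.card F : ℝ) - 1) / 2 := by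
  rw [sum_comp_affine _ hc, sum_nonsqInd hF]

/-- The number of triples `(u, s, t)` with both `u` and `r * u + (t ^ 2 - r * s ^ 2)` nonsquare. -/
def nonsqCorr {F : Type} [Field F] [Fintype F] (r : F) : ℝ :=
  ∑ s : F, ∑ t : F, ∑ u : F, nonsqInd u * nonsqInd (r * u + (t ^ 2 - r * s ^ 2))

lemma nonsqCorr_mul_sq {F : Type} [Field F] [Fintype F] (r : F) {c : F} (hc : c ≠ 0) :
    nonsqCorr (r * c ^ 2) = nonsqCorr r := by
  unfold nonsqCorr
  rw [← sum_comp_affine (fun s => ∑ t : F, ∑ u : F,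
    nonsqInd u * nonsqInd (r * u + (t ^ 2 - r * s ^ 2))) hc 0]
  refine Finset.sum_congr rfl fun s _ => Finset.sum_congr rfl fun t _ => ?_
  rw [← sum_comp_affine (fun u => nonsqInd u * nonsqInd (r * u + (t ^ 2 - r * (c * s + 0) ^ 2)))
    (pow_ne_zero 2 hc) 0]
  refine Finset.sum_congr rfl fun u _ => ?_
  rw [add_zero (c ^ 2 * u), nonsqInd_sq_mul hc]
  ring_nf

lemma nonsqCorr_one {F : Type} [Field F] [Fintype F] (hF : ringChar F ≠ 2) :
    nonsqCorr (1 : F) = ((Fintype.card F : ℝ) - 1) * ((Fintype.card F : ℝ) ^ 2 + 1) / 4 := by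
  classical
  have h2 : (2 : F) ≠ 0 := Ring.two_ne_zero hF
  have h1 : nonsqCorr (1 : F) =
      ∑ t : F, ∑ s : F, ∑ u : F, nonsqInd u * nonsqInd (u + (t ^ 2 + 2 * t * s)) := by
    rw [Finset.sum_comm]
    refine Finset.sum_congr rfl fun s _ => ?_
    rw [← sum_comp_affine (fun t => ∑ u : F, nonsqInd u * nonsqInd (1 * u + (t ^ 2 - 1 * s ^ 2)))
      one_ne_zero s]
    refine Finset.sum_congr rfl fun t _ => Finset.sum_congr rfl fun u _ => ?_
    ring_nf
  have h3 : ∀ t : F, ∑ s : F, ∑ u : F, nonsqInd u * nonsqInd (u + (t ^ 2 + 2 * t * s)) =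
      (((Fintype.card F : ℝ) - 1) / 2) ^ 2 + if t = 0 then
        (Fintype.card F : ℝ) * (((Fintype.card F : ℝ) - 1) / 2)
          - (((Fintype.card F : ℝ) - 1) / 2) ^ 2 else 0 := by
    intro t
    by_cases ht : t = 0
    · subst ht
      simp [nonsqInd_mul_self, sum_nonsqInd hF]
    · rw [Finset.sum_comm]
      have : ∀ u : F, ∑ s : F, nonsqInd u * nonsqInd (u + (t ^ 2 + 2 * t * s)) =
          nonsqInd u * (((Fintype.card F : ℝ) - 1) / 2) := by
        intro u
        rw [← Finset.mul_sum, ← sum_nonsqInd_affine hF (mul_ne_zero h2 ht) (u + t ^ 2)]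
        congr 1
        refine Finset.sum_congr rfl fun s _ => ?_
        ring_nf
      simp_rw [this, ← Finset.sum_mul, sum_nonsqInd hF, if_neg ht]
      ring
  rw [h1]
  simp_rw [h3, Finset.sum_add_distrib, Finset.sum_ite_eq' Finset.univ (0 : F)]
  simp
  ring

lemma nonsqCorr_of_isSquare {F : Type} [Field F] [Fintype F] (hF : ringChar F ≠ 2)
    {r : F} (hr : r ≠ 0) (h : IsSquare r) :
    nonsqCorr r = ((Fintype.card F : ℝ) - 1) * ((Fintype.card F : ℝ) ^ 2 + 1) / 4 := by
  obtain ⟨c, rfl⟩ := h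
  have hc : c ≠ 0 := left_ne_zero_of_mul hr
  rw [← nonsqCorr_one hF, ← nonsqCorr_mul_sq 1 hc, one_mul, sq]

lemma sum_nonsqCorr {F : Type} [Field F] [Fintype F] (hF : ringChar F ≠ 2) :
    ∑ r : F, nonsqCorr r =
      (Fintype.card F : ℝ) ^ 2 * (((Fintype.card F : ℝ) - 1) / 2) ^ 2 := by
  have h : ∀ s t u : F, ∑ r : F, nonsqInd u * nonsqInd (r * u + (t ^ 2 - r * s ^ 2)) =
      nonsqInd u * (((Fintype.card F : ℝ) - 1) / 2) := by
    intro s t u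
    by_cases hu : IsSquare u
    · simp [nonsqInd_of_isSquare hu]
    · have hus : u - s ^ 2 ≠ 0 := fun h => hu ⟨s, by linear_combination h⟩
      rw [← Finset.mul_sum, ← sum_nonsqInd_affine hF hus (t ^ 2)]
      congr 1
      refine Finset.sum_congr rfl fun r _ => ?_
      ring_nf
  unfold nonsqCorr
  rw [Finset.sum_comm]
  conv_lhs => enter [2, s]; rw [Finset.sum_comm]
  conv_lhs => enter [2, s, 2, t]; rw [Finset.sum_comm]
  simp_rw [h, ← Finset.sum_mul, sum_nonsqInd hF]
  simp
  ring

lemma nonsqCorr_of_not_isSquare {F : Type} [Field F] [Fintype F] (hF : ringChar F ≠ 2)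
    {r : F} (hr : ¬ IsSquare r) :
    nonsqCorr r = ((Fintype.card F : ℝ) - 1) * ((Fintype.card F : ℝ) ^ 2 - 1) / 4 := by
  classical
  have hr0 : r ≠ 0 := by rintro rfl; exact hr (IsSquare.zero)
  have hq : (1 : ℝ) < Fintype.card F := by exact_mod_cast Fintype.one_lt_card
  have key : ∀ z : F, nonsqCorr z = nonsqInd z * nonsqCorr r
      + (1 - nonsqInd z - if z = 0 then 1 else 0) *
        (((Fintype.card F : ℝ) - 1) * ((Fintype.card F : ℝ) ^ 2 + 1) / 4) := by
    intro z
    by_cases hz : z = 0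
    · subst hz
      have : ∀ t : F, nonsqInd (t ^ 2) = 0 := fun t => nonsqInd_of_isSquare (IsSquare.sq t)
      simp [nonsqCorr, this, nonsqInd_of_isSquare]
    by_cases h : IsSquare z
    · simp [nonsqInd_of_isSquare h, hz, nonsqCorr_of_isSquare hF hz h]
    · obtain ⟨c, hc⟩ : IsSquare (z * r) := by
        rw [← quadraticChar_one_iff_isSquare (mul_ne_zero hz hr0), map_mul,
          quadraticChar_neg_one_iff_not_isSquare.2 h, quadraticChar_neg_one_iff_not_isSquare.2 hr]
        rfl
      have hc0 : c ≠ 0 := by rintro rfl; simp [hz, hr0] at hc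
      have : z = r * (c / r) ^ 2 := by field_simp; linear_combination hc
      have hcr : c / r ≠ 0 := div_ne_zero hc0 hr0
      rw [nonsqInd_of_not_isSquare h, this, nonsqCorr_mul_sq r hcr]
      simp [hr0, hc0]
  have h := sum_nonsqCorr hF
  rw [Finset.sum_congr rfl fun z _ => key z, Finset.sum_add_distrib, ← Finset.sum_mul,
    ← Finset.sum_mul, Finset.sum_sub_distrib, Finset.sum_sub_distrib, sum_nonsqInd hF] at h
  simp only [Finset.sum_const, Finset.card_univ, nsmul_eq_mul, mul_one, Finset.sum_ite_eq',
    Finset.mem_univ, if_true] at h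
  have hq' : (Fintype.card F : ℝ) - 1 ≠ 0 := by linarith
  apply mul_left_cancel₀ hq'
  linear_combination 2 * h

/-- The discriminant of the quadratic form of agreements between the maps `t ↦ a * t + b`
and `t ↦ (x * t + y) / (t + w)`, for `p = (a, b)` and `m = (x, y, w)`. -/
def agreeDisc {F : Type} [Field F] (p : F × F) (m : F × F × F) : F :=
  (m.1 - p.2 - p.1 * m.2.2) ^ 2 + 4 * p.1 * (m.2.1 - p.2 * m.2.2)

lemma sum_nonsqInd_agreeDisc {F : Type} [Field F] [Fintype F] (hF : ringChar F ≠ 2)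
    {p : F × F} (hp : p.1 ≠ 0) :
    ∑ m : F × F × F, nonsqInd (agreeDisc p m) =
      (Fintype.card F : ℝ) ^ 2 * (((Fintype.card F : ℝ) - 1) / 2) := by
  have h4 : (4 : F) * p.1 ≠ 0 := by
    have := mul_ne_zero (Ring.two_ne_zero hF) (Ring.two_ne_zero hF)
    exact mul_ne_zero (by convert this using 1; norm_num) hp
  simp_rw [Fintype.sum_prod_type]
  have h : ∀ x w : F, ∑ y : F, nonsqInd (agreeDisc p (x, y, w)) =
      ((Fintype.card F : ℝ) - 1) / 2 := by
    intro x w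
    rw [← sum_nonsqInd_affine hF h4 ((x - p.2 - p.1 * w) ^ 2 - 4 * p.1 * (p.2 * w))]
    refine Finset.sum_congr rfl fun y _ => ?_
    simp only [agreeDisc]
    ring_nf
  conv_lhs => enter [2, x]; rw [Finset.sum_comm]
  simp_rw [h]
  simp
  ring

lemma sum_nonsqInd_agreeDisc_mul {F : Type} [Field F] [Fintype F] (hF : ringChar F ≠ 2)
    {p : F × F} (hp : p.1 ≠ 0) (p' : F × F) :
    ∑ m : F × F × F, nonsqInd (agreeDisc p m) * nonsqInd (agreeDisc p' m) =
      ∑ x : F, ∑ w : F, ∑ u : F, nonsqInd u * nonsqInd (p'.1 / p.1 * u +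
        ((x - p'.2 - p'.1 * w) ^ 2 - p'.1 / p.1 * (x - p.2 - p.1 * w) ^ 2
          + 4 * p'.1 * (p.2 - p'.2) * w)) := by
  have h4 : (4 : F) * p.1 ≠ 0 := by
    have := mul_ne_zero (Ring.two_ne_zero hF) (Ring.two_ne_zero hF)
    exact mul_ne_zero (by convert this using 1; norm_num) hp
  simp_rw [Fintype.sum_prod_type]
  refine Finset.sum_congr rfl fun x _ => ?_
  rw [Finset.sum_comm]
  refine Finset.sum_congr rfl fun w _ => ?_
  refine Eq.trans ?_ (sum_comp_affine _ h4 ((x - p.2 - p.1 * w) ^ 2 - 4 * p.1 * (p.2 * w)))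
  refine Finset.sum_congr rfl fun y _ => ?_
  simp only [agreeDisc]
  congr 2
  · ring
  · field_simp
    ring

lemma sum_nonsqInd_agreeDisc_of_fst_eq {F : Type} [Field F] [Fintype F] (hF : ringChar F ≠ 2)
    {a b b' : F} (ha : a ≠ 0) (hb : b ≠ b') :
    ∑ m : F × F × F, nonsqInd (agreeDisc (a, b) m) * nonsqInd (agreeDisc (a, b') m) =
      (Fintype.card F : ℝ) * (((Fintype.card F : ℝ) - 1) / 2) ^ 2 := by
  rw [sum_nonsqInd_agreeDisc_mul hF ha, Finset.sum_comm]
  have hc : 2 * (b - b') ≠ 0 := mul_ne_zero (Ring.two_ne_zero hF) (sub_ne_zero.2 hb)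
  conv_lhs => enter [2, w]; rw [Finset.sum_comm]
  have h : ∀ w u : F, ∑ x : F, nonsqInd u * nonsqInd (a / a * u +
        ((x - b' - a * w) ^ 2 - a / a * (x - b - a * w) ^ 2 + 4 * a * (b - b') * w)) =
      nonsqInd u * (((Fintype.card F : ℝ) - 1) / 2) := by
    intro w u
    rw [← Finset.mul_sum, ← sum_nonsqInd_affine hF hc
      (u + (b' + a * w) ^ 2 - (b + a * w) ^ 2 + 4 * a * (b - b') * w)]
    congr 1
    refine Finset.sum_congr rfl fun x _ => ?_
    rw [div_self ha]
    ring_nf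
  simp_rw [h, ← Finset.sum_mul, sum_nonsqInd hF]
  simp
  ring

lemma sum_nonsqInd_agreeDisc_of_fst_ne {F : Type} [Field F] [Fintype F] (hF : ringChar F ≠ 2)
    {p p' : F × F} (hp : p.1 ≠ 0) (hne : p.1 ≠ p'.1) :
    ∑ m : F × F × F, nonsqInd (agreeDisc p m) * nonsqInd (agreeDisc p' m) =
      nonsqCorr (p'.1 / p.1) := by
  obtain ⟨a, b⟩ := p
  obtain ⟨a', b'⟩ := p'
  simp only at hp hne
  have hd : a - a' ≠ 0 := sub_ne_zero.2 hne
  rw [sum_nonsqInd_agreeDisc_mul hF hp, Finset.sum_comm]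
  unfold nonsqCorr
  obtain ⟨k, hk⟩ : ∃ k, k * (a - a') = b - b' := ⟨(b - b') / (a - a'), by field_simp⟩
  have h1 : ∀ w : F, ∀ g : F → ℝ, ∑ x, g x = ∑ s, g (1 * s + (b + a * w - 2 * a * k)) :=
    fun w g => (sum_comp_affine g one_ne_zero _).symm
  conv_lhs => enter [2, w]; rw [h1 w]
  rw [Finset.sum_comm]
  refine Finset.sum_congr rfl fun s _ => ?_
  rw [← sum_comp_affine (fun t => ∑ u, nonsqInd u *
      nonsqInd (a' / a * u + (t ^ 2 - a' / a * s ^ 2)))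
    hd (s - (a - a') * k)]
  refine Finset.sum_congr rfl fun w _ => Finset.sum_congr rfl fun u _ => ?_
  have hb : b = b' + k * (a - a') := by linear_combination -hk
  subst hb
  congr 2
  simp only
  field_simp
  ring

lemma four_mul_sum_nonsqInd_agreeDisc_mul {F : Type} [Field F] [Fintype F] [DecidableEq F]
    (hF : ringChar F ≠ 2) {p p' : F × F} (hp : p.1 ≠ 0) (hp' : p'.1 ≠ 0) :
    4 * ∑ m : F × F × F, nonsqInd (agreeDisc p m) * nonsqInd (agreeDisc p' m) =
      ((Fintype.card F : ℝ) - 1) * ((Fintype.card F : ℝ) ^ 2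
          + (quadraticChar F p.1 : ℝ) * (quadraticChar F p'.1 : ℝ))
        + ((Fintype.card F : ℝ) ^ 2 - 1) * ((Fintype.card F : ℝ) * (if p = p' then 1 else 0)
          - if p.1 = p'.1 then 1 else 0) := by
  have hsq : ∀ a : F, a ≠ 0 → (quadraticChar F a : ℝ) * quadraticChar F a = 1 := by
    intro a ha
    rw [← sq]
    exact_mod_cast quadraticChar_sq_one ha
  by_cases h1 : p.1 = p'.1
  · by_cases h2 : p = p'
    · subst h2
      simp_rw [nonsqInd_mul_self]
      rw [sum_nonsqInd_agreeDisc hF hp, hsq _ hp]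
      simp
      ring
    · obtain ⟨a, b⟩ := p
      obtain ⟨a', b'⟩ := p'
      simp only at h1 hp
      subst h1
      have hb : b ≠ b' := fun h => h2 (by rw [h])
      rw [sum_nonsqInd_agreeDisc_of_fst_eq hF hp hb, hsq _ hp]
      simp [hb]
      ring
  · have h2 : p ≠ p' := fun h => h1 (by rw [h])
    rw [sum_nonsqInd_agreeDisc_of_fst_ne hF hp h1, if_neg h1, if_neg h2]
    have hmul : (quadraticChar F (p'.1 / p.1) : ℝ) =
        (quadraticChar F p.1 : ℝ) * (quadraticChar F p'.1 : ℝ) := by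
      have h := congrArg (quadraticChar F) (div_mul_cancel₀ p'.1 hp)
      rw [map_mul] at h
      have h' : (quadraticChar F (p'.1 / p.1) : ℝ) * quadraticChar F p.1 =
        quadraticChar F p'.1 := by exact_mod_cast congrArg (Int.cast : ℤ → ℝ) h
      linear_combination (quadraticChar F p.1 : ℝ) * h'
        - (quadraticChar F (p'.1 / p.1) : ℝ) * hsq _ hp
    rw [← hmul]
    have h0 : p'.1 / p.1 ≠ 0 := div_ne_zero hp' hp
    by_cases h : IsSquare (p'.1 / p.1)
    · rw [nonsqCorr_of_isSquare hF h0 h, (quadraticChar_one_iff_isSquare h0).2 h]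
      push_cast
      ring
    · rw [nonsqCorr_of_not_isSquare hF h, quadraticChar_neg_one_iff_not_isSquare.2 h]
      push_cast
      ring

/-- The Bessel inequality for the two characters `1` and `quadraticChar F` of `Fˣ`, applied to the
distribution of first coordinates of `S`. -/
lemma sq_card_add_sq_sum_quadraticChar_le {F : Type} [Field F] [Fintype F] [DecidableEq F]
    (hF : ringChar F ≠ 2) (S : Finset (F × F)) (hS : ∀ p ∈ S, p.1 ≠ 0) :
    (S.card : ℝ) ^ 2 + (∑ p ∈ S, (quadraticChar F p.1 : ℝ)) ^ 2 ≤
      ((Fintype.card F : ℝ) - 1) *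
        ∑ p ∈ S, ∑ p' ∈ S, if p.1 = p'.1 then (1 : ℝ) else 0 := by
  have hq : (1 : ℝ) < Fintype.card F := by exact_mod_cast Fintype.one_lt_card
  set e : F → ℝ := fun a => (quadraticChar F a : ℝ) with he
  set n : F → ℝ := fun a => ∑ p ∈ S, if p.1 = a then 1 else 0 with hn
  have he2 : ∀ a, e a ^ 2 = 1 - if a = 0 then 1 else 0 := by
    intro a
    by_cases ha : a = 0
    · simp [he, ha]
    · have : e a ^ 2 = 1 := by
        simp only [he]
        exact_mod_cast quadraticChar_sq_one ha
      simp [this, ha]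
  have he3 : ∀ a, e a ^ 3 = e a := by
    intro a
    by_cases ha : a = 0
    · simp [he, ha]
    · rw [pow_succ, he2, if_neg ha]; ring
  have hsum : ∑ a, e a = 0 := by
    simp only [he]
    exact_mod_cast congrArg (Int.cast : ℤ → ℝ) (quadraticChar_sum_zero hF)
  have hsum2 : ∑ a, e a ^ 2 = (Fintype.card F : ℝ) - 1 := by
    simp [he2]
  have hpush : ∀ g : F → ℝ, ∑ a, g a * n a = ∑ p ∈ S, g p.1 := by
    intro g
    simp only [hn, Finset.mul_sum]
    rw [Finset.sum_comm]
    simp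
  have hs : ∑ a, e a ^ 2 * n a = S.card := by
    rw [hpush, Finset.sum_congr rfl fun p hp => by rw [he2, if_neg (hS p hp), sub_zero]]
    simp
  have hX := hpush e
  have hN : ∑ a, n a ^ 2 = ∑ p ∈ S, ∑ p' ∈ S, if p.1 = p'.1 then (1 : ℝ) else 0 := by
    simp_rw [sq]
    rw [hpush n]
    refine Finset.sum_congr rfl fun p _ => Finset.sum_congr rfl fun p' _ => ?_
    simp [eq_comm]
  rw [← hN, ← hX]
  set X := ∑ a, e a * n a
  set s := (S.card : ℝ)
  set c : ℝ := (Fintype.card F : ℝ) - 1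
  have hc : 0 < c := sub_pos.2 hq
  have hexp : ∑ a, (c * n a - s * e a ^ 2 - X * e a) ^ 2 =
      c * (c * ∑ a, n a ^ 2 - s ^ 2 - X ^ 2) := by
    have : ∀ a, (c * n a - s * e a ^ 2 - X * e a) ^ 2 = c ^ 2 * n a ^ 2
        - 2 * c * s * (e a ^ 2 * n a) - 2 * c * X * (e a * n a) + (s ^ 2 + X ^ 2) * e a ^ 2
        + 2 * s * X * e a := by
      intro a
      linear_combination (s ^ 2 * e a + 2 * s * X) * he3 a
    simp_rw [this, Finset.sum_add_distrib, Finset.sum_sub_distrib, ← Finset.mul_sum, hs, hsum,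
      hsum2]
    simp only [X, c]
    ring
  have hpos : 0 ≤ c * (c * ∑ a, n a ^ 2 - s ^ 2 - X ^ 2) :=
    hexp ▸ Finset.sum_nonneg fun a _ => sq_nonneg _
  have := nonneg_of_mul_nonneg_right hpos hc
  linarith

lemma sum_sq_sum_nonsqInd_le {F : Type} [Field F] [Fintype F] (hF : ringChar F ≠ 2)
    (S : Finset (F × F)) (hS : ∀ p ∈ S, p.1 ≠ 0) :
    4 * ∑ m : F × F × F, (∑ p ∈ S, nonsqInd (agreeDisc p m)) ^ 2 ≤
      ((Fintype.card F : ℝ) - 1) * (Fintype.card F : ℝ) ^ 2 * (S.card : ℝ) ^ 2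
        + ((Fintype.card F : ℝ) ^ 2 - 1) * (Fintype.card F : ℝ) * S.card
        - ((Fintype.card F : ℝ) + 1) * (S.card : ℝ) ^ 2 := by
  classical
  have hq : (1 : ℝ) < Fintype.card F := by exact_mod_cast Fintype.one_lt_card
  have h1 : 4 * ∑ m : F × F × F, (∑ p ∈ S, nonsqInd (agreeDisc p m)) ^ 2 =
      ∑ p ∈ S, ∑ p' ∈ S,
        4 * ∑ m : F × F × F, nonsqInd (agreeDisc p m) * nonsqInd (agreeDisc p' m) := by
    simp_rw [← Finset.mul_sum, sq, Finset.sum_mul_sum]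
    rw [Finset.sum_comm]
    congr 1
    exact Finset.sum_congr rfl fun p _ => Finset.sum_comm
  rw [h1, Finset.sum_congr rfl fun p hp => Finset.sum_congr rfl fun p' hp' =>
    four_mul_sum_nonsqInd_agreeDisc_mul hF (hS p hp) (hS p' hp')]
  have h2 : ∑ p ∈ S, ∑ p' ∈ S, (if p = p' then (1 : ℝ) else 0) = S.card := by
    rw [Finset.sum_congr rfl fun p hp => by rw [Finset.sum_ite_eq, if_pos hp]]
    simp
  simp_rw [Finset.sum_add_distrib, ← Finset.mul_sum, Finset.sum_add_distrib,
    Finset.sum_sub_distrib, ← Finset.mul_sum, h2, ← Finset.sum_mul]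
  simp only [Finset.sum_const, nsmul_eq_mul]
  have h3 := sq_card_add_sq_sum_quadraticChar_le hF S hS
  set X := ∑ p ∈ S, (quadraticChar F p.1 : ℝ)
  set N := ∑ p ∈ S, ∑ p' ∈ S, if p.1 = p'.1 then (1 : ℝ) else 0
  nlinarith [mul_le_mul_of_nonneg_left h3 (by linarith : (0 : ℝ) ≤ Fintype.card F + 1),
    sq_nonneg X]

lemma isSquare_agreeDisc_of_det_eq_zero {F : Type} [Field F] (p : F × F) {m : F × F × F}
    (hm : m.1 * m.2.2 - m.2.1 = 0) : IsSquare (agreeDisc p m) :=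
  ⟨m.1 - p.2 + p.1 * m.2.2, by unfold agreeDisc; linear_combination (-4 * p.1) * hm⟩

lemma card_filter_det_ne_zero {F : Type} [Field F] [Fintype F] [DecidableEq F] :
    ((Finset.univ.filter fun m : F × F × F => m.1 * m.2.2 - m.2.1 ≠ 0).card : ℝ) =
      (Fintype.card F : ℝ) ^ 2 * ((Fintype.card F : ℝ) - 1) := by
  rw [Finset.card_filter]
  push_cast
  simp_rw [Fintype.sum_prod_type]
  have h : ∀ x w : F, ∑ y : F, (if x * w - y ≠ 0 then (1 : ℝ) else 0) = Fintype.card F - 1 := by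
    intro x w
    have : ∀ y : F, (if x * w - y ≠ 0 then (1 : ℝ) else 0) = 1 - if x * w = y then 1 else 0 := by
      intro y
      by_cases hy : x * w = y <;> simp [sub_eq_zero, hy]
    simp_rw [this]
    simp
  conv_lhs => enter [2, x]; rw [Finset.sum_comm]
  simp_rw [h]
  simp
  ring

lemma card_mul_card_le_of_isSquare_agreeDisc {F : Type} [Field F] [Fintype F]
    (hF : ringChar F ≠ 2) (S : Finset (F × F)) (T : Finset (F × F × F))
    (hS : ∀ p ∈ S, p.1 ≠ 0) (hT : ∀ m ∈ T, m.1 * m.2.2 - m.2.1 ≠ 0)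
    (hST : ∀ p ∈ S, ∀ m ∈ T, IsSquare (agreeDisc p m)) :
    (S.card : ℝ) * T.card ≤ (Fintype.card F : ℝ) * ((Fintype.card F : ℝ) ^ 2 - 1)
      * (1 - (S.card : ℝ) / ((Fintype.card F : ℝ) * ((Fintype.card F : ℝ) - 1)))
      * (1 - (T.card : ℝ) / ((Fintype.card F : ℝ) ^ 2 * ((Fintype.card F : ℝ) - 1))) := by
  classical
  have hq : (1 : ℝ) < Fintype.card F := by exact_mod_cast Fintype.one_lt_card
  set Y := Finset.univ.filter fun m : F × F × F => m.1 * m.2.2 - m.2.1 ≠ 0 with hY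
  have hYcard := card_filter_det_ne_zero (F := F)
  rw [← hY] at hYcard
  have hTY : T ⊆ Y := fun m hm => by simp [hY, hT m hm]
  set d : F × F × F → ℝ := fun m => ∑ p ∈ S, nonsqInd (agreeDisc p m) with hd
  have hd0 : ∀ m, m ∉ Y \ T → d m = 0 := by
    intro m hm
    refine Finset.sum_eq_zero fun p hp => nonsqInd_of_isSquare ?_
    by_cases hmT : m ∈ T
    · exact hST p hp m hmT
    · refine isSquare_agreeDisc_of_det_eq_zero p ?_
      by_contra h
      exact hm (by simp [hY, h, hmT])
  have hsum : ∑ m, d m =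
      S.card * ((Fintype.card F : ℝ) ^ 2 * (((Fintype.card F : ℝ) - 1) / 2)) := by
    simp only [hd]
    rw [Finset.sum_comm, Finset.sum_congr rfl fun p hp => sum_nonsqInd_agreeDisc hF (hS p hp)]
    simp
  have hsub : ∑ m ∈ Y \ T, d m = ∑ m, d m :=
    Finset.sum_subset (Finset.subset_univ _) fun m _ hm => hd0 m hm
  have hsub2 : ∑ m ∈ Y \ T, d m ^ 2 = ∑ m, d m ^ 2 :=
    Finset.sum_subset (Finset.subset_univ _) fun m _ hm => by simp [hd0 m hm]
  have hcs := sq_sum_le_card_mul_sum_sq (s := Y \ T) (f := d)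
  have hcard : ((Y \ T).card : ℝ) = Y.card - T.card := by
    rw [Finset.card_sdiff_of_subset hTY, Nat.cast_sub (Finset.card_le_card hTY)]
  have hE := sum_sq_sum_nonsqInd_le hF S hS
  rw [hsub, hsub2, hsum, hcard, hYcard] at hcs
  have hTle : (T.card : ℝ) ≤ (Fintype.card F : ℝ) ^ 2 * ((Fintype.card F : ℝ) - 1) := by
    rw [← hYcard]
    exact_mod_cast Finset.card_le_card hTY
  change 4 * ∑ m, d m ^ 2 ≤ _ at hE
  generalize (Fintype.card F : ℝ) = q at *
  generalize ∑ m, d m ^ 2 = E at *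
  generalize (T.card : ℝ) = t at *
  have hs0 : (0 : ℝ) ≤ S.card := Nat.cast_nonneg _
  generalize (S.card : ℝ) = s at *
  have hq0 : 0 < q := by linarith
  have hq1 : 0 < q - 1 := by linarith
  have key : 0 ≤ (q + 1) * (q * (q - 1) - s) * (q ^ 2 * (q - 1) - t)
      - q ^ 2 * (q - 1) * (s * t) := by
    rcases hs0.eq_or_lt with rfl | hs
    · have : 0 ≤ (q + 1) * (q * (q - 1)) * (q ^ 2 * (q - 1) - t) :=
        mul_nonneg (by positivity) (by linarith)
      linarith
    · have h1 := mul_le_mul_of_nonneg_left hE (sub_nonneg.2 hTle)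
      have h2 : 0 ≤ s * ((q + 1) * (q * (q - 1) - s) * (q ^ 2 * (q - 1) - t)
        - q ^ 2 * (q - 1) * (s * t)) := by linarith
      exact nonneg_of_mul_nonneg_right h2 hs
  have : q * (q ^ 2 - 1) * (1 - s / (q * (q - 1))) * (1 - t / (q ^ 2 * (q - 1))) - s * t =
      ((q + 1) * (q * (q - 1) - s) * (q ^ 2 * (q - 1) - t) - q ^ 2 * (q - 1) * (s * t))
        / (q ^ 2 * (q - 1)) := by
    field_simp
    ring
  have h0 := div_nonneg key (by positivity : (0 : ℝ) ≤ q ^ 2 * (q - 1))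
  linarith

lemma indMap_mk {F : Type} [Field F] (M : GL (Fin 2) F) (v : Fin 2 → F) (hv : v ≠ 0)
    (hMv : M.1.mulVec v ≠ 0) :
    indMap M (Projectivization.mk F v hv) = Projectivization.mk F (M.1.mulVec v) hMv := rfl

lemma mulVec_ne_zero_of_GL {F : Type} [Field F] (M : GL (Fin 2) F) {v : Fin 2 → F}
    (hv : v ≠ 0) : M.1.mulVec v ≠ 0 := by
  intro h
  refine hv ?_
  have := congrArg (M⁻¹.1.mulVec) h
  rwa [Matrix.mulVec_mulVec, Matrix.mulVec_zero, ← Units.val_mul, inv_mul_cancel,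
    Units.val_one, Matrix.one_mulVec] at this

lemma indMap_mul {F : Type} [Field F] (M N : GL (Fin 2) F)
    (x : Projectivization F (Fin 2 → F)) : indMap (M * N) x = indMap M (indMap N x) := by
  induction x using Projectivization.ind with
  | h v hv =>
    have hN := mulVec_ne_zero_of_GL N hv
    rw [indMap_mk N v hv hN, indMap_mk M _ hN (mulVec_ne_zero_of_GL M hN),
      indMap_mk (M * N) v hv (mulVec_ne_zero_of_GL _ hv)]
    congr 1
    rw [Units.val_mul, Matrix.mulVec_mulVec]

lemma indMap_eq_of_smul {F : Type} [Field F] {M N : GL (Fin 2) F} {c : F}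
    (h : M.1 = c • N.1) : indMap M = indMap N := by
  ext x
  induction x using Projectivization.ind with
  | h v hv =>
    rw [indMap_mk M v hv (mulVec_ne_zero_of_GL M hv), indMap_mk N v hv (mulVec_ne_zero_of_GL N hv),
      Projectivization.mk_eq_mk_iff']
    exact ⟨c, by rw [h, Matrix.smul_mulVec]⟩

lemma exists_det_sub_smul_eq_zero {F : Type} [Field F] {M N : GL (Fin 2) F}
    {x : Projectivization F (Fin 2 → F)} (h : indMap M x = indMap N x) :
    ∃ c : F, (M.1 - c • N.1).det = 0 := by
  induction x using Projectivization.ind with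
  | h v hv =>
    rw [indMap_mk M v hv (mulVec_ne_zero_of_GL M hv), indMap_mk N v hv (mulVec_ne_zero_of_GL N hv),
      Projectivization.mk_eq_mk_iff'] at h
    obtain ⟨c, hc⟩ := h
    refine ⟨c, Matrix.exists_mulVec_eq_zero_iff.1 ⟨v, hv, ?_⟩⟩
    rw [Matrix.sub_mulVec, Matrix.smul_mulVec, hc, sub_self]

/-- The point `[1 : 0]` of the projective line. -/
def pointAtInfinity (F : Type) [Field F] : Projectivization F (Fin 2 → F) :=
  Projectivization.mk F ![1, 0] (by simp)

lemma exists_indMap_pointAtInfinity {F : Type} [Field F] (P : Projectivization F (Fin 2 → F)) :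
    ∃ A : GL (Fin 2) F, indMap A (pointAtInfinity F) = P := by
  induction P using Projectivization.ind with
  | h v hv =>
    have main : ∀ B : Matrix (Fin 2) (Fin 2) F, B.det ≠ 0 → B.mulVec ![1, 0] = v →
        ∃ A : GL (Fin 2) F, indMap A (pointAtInfinity F) = Projectivization.mk F v hv := by
      intro B hB hBv
      refine ⟨Matrix.GeneralLinearGroup.mkOfDetNeZero B hB, ?_⟩
      subst hBv
      rfl
    by_cases h0 : v 0 = 0
    · have h1 : v 1 ≠ 0 := fun h1 => hv (by ext i; fin_cases i <;> simp [h0, h1])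
      refine main !![0, 1; v 1, 0] (by simpa [Matrix.det_fin_two] using h1) ?_
      ext i; fin_cases i <;> simp [h0, Matrix.mulVec, dotProduct]
    · refine main !![v 0, 0; v 1, 1] (by simpa [Matrix.det_fin_two] using h0) ?_
      ext i; fin_cases i <;> simp [Matrix.mulVec, dotProduct]

lemma indMap_pointAtInfinity_eq_iff {F : Type} [Field F] (M : GL (Fin 2) F) :
    indMap M (pointAtInfinity F) = pointAtInfinity F ↔ M.1 1 0 = 0 := by
  have hv : (![1, 0] : Fin 2 → F) ≠ 0 := by simp
  unfold pointAtInfinity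
  rw [indMap_mk M _ hv (mulVec_ne_zero_of_GL M hv), Projectivization.mk_eq_mk_iff']
  constructor
  · rintro ⟨c, hc⟩
    simpa [Matrix.mulVec, dotProduct] using (congrFun hc 1).symm
  · intro h
    refine ⟨M.1 0 0, ?_⟩
    ext i; fin_cases i <;> simp [h, Matrix.mulVec, dotProduct]

/-- The coefficients `(a, b)` of the map `t ↦ a * t + b` induced by an upper triangular matrix. -/
def affineCoeffs {F : Type} [Field F] (M : Matrix (Fin 2) (Fin 2) F) : F × F :=
  (M 0 0 / M 1 1, M 0 1 / M 1 1)

/-- The coefficients `(x, y, w)` of the map `t ↦ (x * t + y) / (t + w)` induced by a matrix with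
nonzero lower left entry. -/
def fractionalCoeffs {F : Type} [Field F] (M : Matrix (Fin 2) (Fin 2) F) : F × F × F :=
  (M 0 0 / M 1 0, M 0 1 / M 1 0, M 1 1 / M 1 0)

lemma isSquare_agreeDisc_of_det_sub_smul {F : Type} [Field F] {M N : Matrix (Fin 2) (Fin 2) F}
    (hM : M 1 0 = 0) (hM' : M 1 1 ≠ 0) (hN : N 1 0 ≠ 0) {c : F} (h : (M - c • N).det = 0) :
    IsSquare (agreeDisc (affineCoeffs M) (fractionalCoeffs N)) := by
  rw [Matrix.det_fin_two] at h
  simp only [Matrix.sub_apply, Matrix.smul_apply, smul_eq_mul, hM] at h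
  unfold agreeDisc affineCoeffs fractionalCoeffs
  simp only
  generalize M 0 0 = a at *
  generalize M 0 1 = b at *
  generalize M 1 1 = d at *
  generalize N 0 0 = x at *
  generalize N 0 1 = y at *
  generalize N 1 1 = w at *
  generalize N 1 0 = z at *
  obtain ⟨a, rfl⟩ : ∃ a', a = a' * d := ⟨a / d, by field_simp⟩
  obtain ⟨b, rfl⟩ : ∃ b', b = b' * d := ⟨b / d, by field_simp⟩
  obtain ⟨c, rfl⟩ : ∃ c', c = c' * d / z := ⟨c * z / d, by field_simp⟩
  obtain ⟨x, rfl⟩ : ∃ x', x = x' * z := ⟨x / z, by field_simp⟩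
  obtain ⟨y, rfl⟩ : ∃ y', y = y' * z := ⟨y / z, by field_simp⟩
  obtain ⟨w, rfl⟩ : ∃ w', w = w' * z := ⟨w / z, by field_simp⟩
  simp only [mul_div_cancel_right₀ _ hM', mul_div_cancel_right₀ _ hN]
  have hroot : (a - c * x) * (1 - c * w) + (b - c * y) * c = 0 := by
    apply mul_left_cancel₀ (pow_ne_zero 2 hM')
    field_simp at h
    linear_combination h
  exact ⟨2 * (x * w - y) * c - (x + a * w - b), by
    linear_combination (-4 * (x * w - y)) * hroot⟩

/-- **Few-or-many via the expander mixing lemma for `PGL(2,q)`, `q` odd.** For an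
intersecting family `𝒻 ⊆ 𝕄`, a point pair `(P,Q)`, `S = {f ∈ 𝒻 : f(P) = Q}` and
`T = 𝒻 \ S`, one has `|S|·|T| ≤ q(q²−1)(1 − |S|/(q(q−1)))(1 − |T|/(q²(q−1)))`. -/
theorem stmt_18 (q : ℕ) (hq : Odd q) (hqp : IsPrimePow q)
    (F : Type) [Field F] [Fintype F] (hF : Fintype.card F = q)
    (𝒻 : Set (Projectivization F (Fin 2 → F) → Projectivization F (Fin 2 → F)))
    (h𝒻 : 𝒻 ⊆ pglMaps F)
    (hint : ∀ f ∈ 𝒻, ∀ g ∈ 𝒻, ∃ x, f x = g x)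
    (P Q : Projectivization F (Fin 2 → F))
    (S T : Set (Projectivization F (Fin 2 → F) → Projectivization F (Fin 2 → F)))
    (hS : S = {f ∈ 𝒻 | f P = Q}) (hT : T = 𝒻 \ S) :
    (S.ncard : ℝ) * (T.ncard : ℝ) ≤
      (q : ℝ) * ((q : ℝ) ^ 2 - 1) * (1 - (S.ncard : ℝ) / ((q : ℝ) * ((q : ℝ) - 1)))
        * (1 - (T.ncard : ℝ) / ((q : ℝ) ^ 2 * ((q : ℝ) - 1))) := by
  classical
  subst hF
  have hchar : ringChar F ≠ 2 := by
    intro h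
    have := FiniteField.even_card_of_char_two h
    rw [Nat.odd_iff] at hq
    omega
  obtain ⟨A, rfl⟩ := exists_indMap_pointAtInfinity P
  obtain ⟨B, rfl⟩ := exists_indMap_pointAtInfinity Q
  have hex : ∀ f, ∃ N : GL (Fin 2) F, f ∈ 𝒻 → indMap (B * N * A⁻¹) = f := by
    intro f
    by_cases hf : f ∈ 𝒻
    · obtain ⟨M, hM⟩ := h𝒻 hf
      exact ⟨B⁻¹ * M * A, fun _ => by rw [← hM]; congr 1; group⟩
    · exact ⟨1, fun h => absurd h hf⟩
  choose N hN using hex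
  have hinj : ∀ f ∈ 𝒻, ∀ g ∈ 𝒻, ∀ c : F, (N f).1 = c • (N g).1 → f = g := by
    intro f hf g hg c h
    rw [← hN f hf, ← hN g hg]
    refine indMap_eq_of_smul (c := c) ?_
    simp only [Units.val_mul, h, Matrix.mul_smul, Matrix.smul_mul]
  have hdet : ∀ f ∈ 𝒻, ∀ g ∈ 𝒻, ∃ c : F, ((N f).1 - c • (N g).1).det = 0 := by
    intro f hf g hg
    obtain ⟨x, hx⟩ := hint f hf g hg
    rw [← hN f hf, ← hN g hg] at hx
    simp only [mul_assoc, indMap_mul B] at hx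
    have hB : Function.Injective (indMap B) := Projectivization.map_injective _ _
    have hx' := hB hx
    rw [indMap_mul, indMap_mul] at hx'
    exact exists_det_sub_smul_eq_zero hx'
  have hfix : ∀ f ∈ 𝒻, (f (indMap A (pointAtInfinity F)) = indMap B (pointAtInfinity F) ↔
      (N f).1 1 0 = 0) := by
    intro f hf
    have hB : Function.Injective (indMap B) := Projectivization.map_injective _ _
    rw [← indMap_pointAtInfinity_eq_iff]
    conv_lhs => rw [← hN f hf]
    rw [← indMap_mul, inv_mul_cancel_right, indMap_mul, hB.eq_iff]
  have hN0 : ∀ f, (N f).1 0 0 * (N f).1 1 1 - (N f).1 0 1 * (N f).1 1 0 ≠ 0 := by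
    intro f
    rw [← Matrix.det_fin_two]
    exact Matrix.GeneralLinearGroup.det_ne_zero (N f)
  have hSmem : ∀ f ∈ S, f ∈ 𝒻 ∧ (N f).1 1 0 = 0 ∧ (N f).1 0 0 ≠ 0 ∧ (N f).1 1 1 ≠ 0 := by
    intro f hf
    rw [hS] at hf
    have h10 := (hfix f hf.1).1 hf.2
    have h := hN0 f
    rw [h10, mul_zero, sub_zero] at h
    exact ⟨hf.1, h10, left_ne_zero_of_mul h, right_ne_zero_of_mul h⟩
  have hTmem : ∀ f ∈ T, f ∈ 𝒻 ∧ (N f).1 1 0 ≠ 0 := by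
    intro f hf
    rw [hT, hS] at hf
    exact ⟨hf.1, fun h => hf.2 ⟨hf.1, (hfix f hf.1).2 h⟩⟩
  have hSinj : Set.InjOn (fun f => affineCoeffs (N f).1) S := by
    intro f hf g hg h
    obtain ⟨hf1, hf2, hf3, hf4⟩ := hSmem f hf
    obtain ⟨hg1, hg2, hg3, hg4⟩ := hSmem g hg
    simp only [affineCoeffs, Prod.mk.injEq] at h
    refine hinj f hf1 g hg1 ((N f).1 1 1 / (N g).1 1 1) ?_
    have h1 := (div_eq_div_iff hf4 hg4).1 h.1
    have h2 := (div_eq_div_iff hf4 hg4).1 h.2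
    ext i j
    fin_cases i <;> fin_cases j <;>
      simp only [Matrix.smul_apply, smul_eq_mul, Fin.zero_eta, Fin.mk_one, hf2, hg2, mul_zero] <;>
      field_simp
    · linear_combination h1
    · linear_combination h2
  have hTinj : Set.InjOn (fun f => fractionalCoeffs (N f).1) T := by
    intro f hf g hg h
    obtain ⟨hf1, hf2⟩ := hTmem f hf
    obtain ⟨hg1, hg2⟩ := hTmem g hg
    simp only [fractionalCoeffs, Prod.mk.injEq] at h
    refine hinj f hf1 g hg1 ((N f).1 1 0 / (N g).1 1 0) ?_
    have h1 := (div_eq_div_iff hf2 hg2).1 h.1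
    have h2 := (div_eq_div_iff hf2 hg2).1 h.2.1
    have h3 := (div_eq_div_iff hf2 hg2).1 h.2.2
    ext i j
    fin_cases i <;> fin_cases j <;>
      simp only [Matrix.smul_apply, smul_eq_mul, Fin.zero_eta, Fin.mk_one] <;>
      field_simp
    · linear_combination h1
    · linear_combination h2
    · linear_combination h3
  rw [← hSinj.ncard_image, ← hTinj.ncard_image,
    Set.ncard_eq_toFinset_card', Set.ncard_eq_toFinset_card']
  apply card_mul_card_le_of_isSquare_agreeDisc hchar
  · intro p hp
    obtain ⟨f, hf, rfl⟩ := Set.mem_toFinset.1 hp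
    obtain ⟨-, -, h3, h4⟩ := hSmem f hf
    exact div_ne_zero h3 h4
  · intro m hm
    obtain ⟨f, hf, rfl⟩ := Set.mem_toFinset.1 hm
    obtain ⟨-, h2⟩ := hTmem f hf
    have h := hN0 f
    simp only [fractionalCoeffs]
    intro h0
    field_simp at h0
    exact h (by linear_combination h0)
  · intro p hp m hm
    obtain ⟨f, hf, rfl⟩ := Set.mem_toFinset.1 hp
    obtain ⟨g, hg, rfl⟩ := Set.mem_toFinset.1 hm
    obtain ⟨hf1, hf2, -, hf4⟩ := hSmem f hf
    obtain ⟨hg1, hg2⟩ := hTmem g hg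
    obtain ⟨c, hc⟩ := hdet f hf1 g hg1
    exact isSquare_agreeDisc_of_det_sub_smul hf2 hf4 hg2 hc
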